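/- Let a₁, a₂, a₃ be nonzero real numbers, c a real number, and let {·,·}_D be the Dirac bracket on ℝ³×ℝ³ associated with F₁ = x₁²/a₁ + x₂²/a₂ + x₃²/a₃ − 1 and F₂ = x₁p₁/a₁ + x₂p₂/a₂ + x₃p₃/a₃. Define the real functions H = (a₂p₂x₃ − a₃p₃x₂)²/(a₂a₃) + (a₁p₁x₃ − a₃p₃x₁)²/(a₁a₃) + 4(a₁p₁x₂ − a₂p₂x₁)²/(a₁a₂) − 2c x₂ and K = (a₂p₂x₁ − a₁p₁x₂)·[(a₂p₂x₃ − a₃p₃x₂)²/(a₂a₃) + (a₁p₁x₃ − a₃p₃x₁)²/(a₁a₃)] + c a₂ x₃(a₁p₁x₃ − a₃p₃x₁)/a₃. Then {H, K}_D = 0 at every point of the constraint surface (where F₁ = 0 and F₂ = 0). (These are the real integrals of the Goryachev–Chaplygin system on the ellipsoid or hyperboloid, obtained after the coupling-constant transformation c → c√a₂ and rescaling K by √a₁√a₂.) -/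

import Mathlib

noncomputable section

/-- Phase space T*ℝ³ = ℝ³ × ℝ³ with coordinates (x, p). -/
abbrev Phase : Type := (Fin 3 → ℝ) × (Fin 3 → ℝ)

/-- Canonical Poisson bracket on ℝ³ × ℝ³:
{f,g} = Σᵢ (∂f/∂xᵢ ∂g/∂pᵢ − ∂f/∂pᵢ ∂g/∂xᵢ). -/
noncomputable def pb (f g : Phase → ℝ) (z : Phase) : ℝ :=
  ∑ i : Fin 3,
    (fderiv ℝ f z (Pi.single i 1, 0) * fderiv ℝ g z (0, Pi.single i 1) -
     fderiv ℝ f z (0, Pi.single i 1) * fderiv ℝ g z (Pi.single i 1, 0))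

/-- Dirac bracket associated with constraints F₁, F₂:
{f,g}_D = {f,g} − ({F₁,f}{F₂,g} − {F₁,g}{F₂,f})/{F₁,F₂}. -/
noncomputable def dirac (F₁ F₂ f g : Phase → ℝ) (z : Phase) : ℝ :=
  pb f g z - (pb F₁ f z * pb F₂ g z - pb F₁ g z * pb F₂ f z) / pb F₁ F₂ z
/-- Ellipsoid/hyperboloid constraint F₁ = x₁²/a₁ + x₂²/a₂ + x₃²/a₃ − 1. -/
noncomputable def ellF₁ (a₁ a₂ a₃ : ℝ) : Phase → ℝ := fun z =>
  z.1 0 ^ 2 / a₁ + z.1 1 ^ 2 / a₂ + z.1 2 ^ 2 / a₃ - 1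

/-- Ellipsoid/hyperboloid constraint F₂ = x₁p₁/a₁ + x₂p₂/a₂ + x₃p₃/a₃. -/
noncomputable def ellF₂ (a₁ a₂ a₃ : ℝ) : Phase → ℝ := fun z =>
  z.1 0 * z.2 0 / a₁ + z.1 1 * z.2 1 / a₂ + z.1 2 * z.2 2 / a₃

/-- Dirac bracket {·,·}_D on the ellipsoid/hyperboloid. -/
noncomputable def diracE (a₁ a₂ a₃ : ℝ) (f g : Phase → ℝ) (z : Phase) : ℝ :=
  dirac (ellF₁ a₁ a₂ a₃) (ellF₂ a₁ a₂ a₃) f g z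

/-- The position coordinate `xᵢ` as a continuous linear functional on phase space. -/
def positionCLM (i : Fin 3) : Phase →L[ℝ] ℝ :=
  (ContinuousLinearMap.proj i).comp (ContinuousLinearMap.fst ℝ (Fin 3 → ℝ) (Fin 3 → ℝ))

/-- The momentum coordinate `pᵢ` as a continuous linear functional on phase space. -/
def momentumCLM (i : Fin 3) : Phase →L[ℝ] ℝ :=
  (ContinuousLinearMap.proj i).comp (ContinuousLinearMap.snd ℝ (Fin 3 → ℝ) (Fin 3 → ℝ))

@[simp]
theorem positionCLM_apply (i : Fin 3) (z : Phase) : positionCLM i z = z.1 i := rfl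

@[simp]
theorem momentumCLM_apply (i : Fin 3) (z : Phase) : momentumCLM i z = z.2 i := rfl

theorem hasFDerivAt_position (i : Fin 3) (z : Phase) :
    HasFDerivAt (fun w : Phase => w.1 i) (positionCLM i) z :=
  (positionCLM i).hasFDerivAt

theorem hasFDerivAt_momentum (i : Fin 3) (z : Phase) :
    HasFDerivAt (fun w : Phase => w.2 i) (momentumCLM i) z :=
  (momentumCLM i).hasFDerivAt

/-- The derivative of the rescaled angular momentum `a pᵢ xⱼ - b pⱼ xᵢ`. -/
theorem hasFDerivAt_angularMomentum (a b : ℝ) (i j : Fin 3) (z : Phase) :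
    HasFDerivAt (fun w : Phase => a * w.2 i * w.1 j - b * w.2 j * w.1 i)
      ((a * z.2 i) • positionCLM j + z.1 j • a • momentumCLM i -
        ((b * z.2 j) • positionCLM i + z.1 i • b • momentumCLM j)) z :=
  (((hasFDerivAt_momentum i z).const_mul a).mul (hasFDerivAt_position j z)).sub
    (((hasFDerivAt_momentum j z).const_mul b).mul (hasFDerivAt_position i z))

/-- real Goryachev–Chaplygin integrals on the ellipsoid/hyperboloid
(after c → c√a₂ and rescaling of K by √a₁√a₂) are in involution with respect to
the Dirac bracket on the constraint surface. -/
theorem goryachev_chaplygin_ellipsoid_involution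
    (a₁ a₂ a₃ : ℝ) (ha₁ : a₁ ≠ 0) (ha₂ : a₂ ≠ 0) (ha₃ : a₃ ≠ 0) (c : ℝ)
    (z : Phase)
    (h1 : ellF₁ a₁ a₂ a₃ z = 0) (h2 : ellF₂ a₁ a₂ a₃ z = 0) :
    diracE a₁ a₂ a₃
      (fun w => (a₂ * w.2 1 * w.1 2 - a₃ * w.2 2 * w.1 1) ^ 2 / (a₂ * a₃) +
        (a₁ * w.2 0 * w.1 2 - a₃ * w.2 2 * w.1 0) ^ 2 / (a₁ * a₃) +
        4 * (a₁ * w.2 0 * w.1 1 - a₂ * w.2 1 * w.1 0) ^ 2 / (a₁ * a₂) -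
        2 * c * w.1 1)
      (fun w => (a₂ * w.2 1 * w.1 0 - a₁ * w.2 0 * w.1 1) *
          ((a₂ * w.2 1 * w.1 2 - a₃ * w.2 2 * w.1 1) ^ 2 / (a₂ * a₃) +
           (a₁ * w.2 0 * w.1 2 - a₃ * w.2 2 * w.1 0) ^ 2 / (a₁ * a₃)) +
        c * a₂ * w.1 2 * (a₁ * w.2 0 * w.1 2 - a₃ * w.2 2 * w.1 0) / a₃) z = 0 := by
  have dF := ((((hasFDerivAt_position 0 z).pow 2).mul_const a₁⁻¹).add
    (((hasFDerivAt_position 1 z).pow 2).mul_const a₂⁻¹)).add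
    (((hasFDerivAt_position 2 z).pow 2).mul_const a₃⁻¹) |>.sub_const 1
  have dA := ((hasFDerivAt_angularMomentum a₂ a₃ 1 2 z).pow 2).mul_const (a₂ * a₃)⁻¹
  have dB := ((hasFDerivAt_angularMomentum a₁ a₃ 0 2 z).pow 2).mul_const (a₁ * a₃)⁻¹
  have dC := (((hasFDerivAt_angularMomentum a₁ a₂ 0 1 z).pow 2).const_mul 4).mul_const
    (a₁ * a₂)⁻¹
  have dH := ((dA.add dB).add dC).sub ((hasFDerivAt_position 1 z).const_mul (2 * c))
  have dK := ((hasFDerivAt_angularMomentum a₂ a₁ 1 0 z).mul (dA.add dB)).add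
    ((((hasFDerivAt_position 2 z).const_mul (c * a₂)).mul
      (hasFDerivAt_angularMomentum a₁ a₃ 0 2 z)).mul_const a₃⁻¹)
  unfold diracE dirac
  set H : Phase → ℝ := fun w => (a₂ * w.2 1 * w.1 2 - a₃ * w.2 2 * w.1 1) ^ 2 / (a₂ * a₃) +
        (a₁ * w.2 0 * w.1 2 - a₃ * w.2 2 * w.1 0) ^ 2 / (a₁ * a₃) +
        4 * (a₁ * w.2 0 * w.1 1 - a₂ * w.2 1 * w.1 0) ^ 2 / (a₁ * a₂) -
        2 * c * w.1 1
  set K : Phase → ℝ := fun w => (a₂ * w.2 1 * w.1 0 - a₁ * w.2 0 * w.1 1) *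
          ((a₂ * w.2 1 * w.1 2 - a₃ * w.2 2 * w.1 1) ^ 2 / (a₂ * a₃) +
           (a₁ * w.2 0 * w.1 2 - a₃ * w.2 2 * w.1 0) ^ 2 / (a₁ * a₃)) +
        c * a₂ * w.1 2 * (a₁ * w.2 0 * w.1 2 - a₃ * w.2 2 * w.1 0) / a₃
  have eF : fderiv ℝ (ellF₁ a₁ a₂ a₃) z = _ := dF.fderiv
  have eH : fderiv ℝ H z = _ := dH.fderiv
  have eK : fderiv ℝ K z = _ := dK.fderiv
  have hFH : pb (ellF₁ a₁ a₂ a₃) H z = 0 := by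
    simp only [pb, eF, eH, Fin.sum_univ_three]
    simp
    field_simp
    ring
  have hFK : pb (ellF₁ a₁ a₂ a₃) K z = 0 := by
    simp only [pb, eF, eK, Fin.sum_univ_three]
    simp
    field_simp
    ring
  have hHK : pb H K z = 0 := by
    simp only [pb, eH, eK, Fin.sum_univ_three]
    simp
    field_simp
    ring
  rw [hFH, hFK, hHK]
  simp
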